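/- Let n be a positive integer, let α be the standard contact form on M = ℝ^{2n+1}, β = dα its constant exterior derivative, and R = (0, 0, 1) its Reeb vector. Let ε > 0 and H : M × (−ε, ε) → ℝ a smooth function; write H^t = H(·, t) and let D₁H(u,t) denote the derivative of H in the M-variable. Suppose X : M × (−ε, ε) → ℝ^{2n+1} is a smooth time-dependent vector field satisfying, for all u and t, α_u(X(u,t)) = H(u,t) and β(X(u,t), v) = −D₁H(u,t)(v) + D₁H(u,t)(R)·α_u(v) for all v ∈ ℝ^{2n+1} (the contact Hamiltonian vector fields X_{H^t}), and suppose ψ : M × (−ε, ε) → M is a smooth map with ψ(u, 0) = u and ∂ψ/∂t(u, t) = X(ψ(u,t), t). Set λ(u,t) = exp( ∫₀ᵗ D₁H(ψ(u,s), s)(R) ds ). Then: (a) for all u, t and v ∈ ℝ^{2n+1}, α_{ψ(u,t)}( D_u ψ(·, t)(v) ) = λ(u,t)·α_u(v) (i.e. ψ_t^* α = e^{∫₀ᵗ θ(s) ds} α where θ(s) = ψ_s^*(dH^s(R))); and (b) the map F : M × (−ε, ε) → M × (−ε, ε), F(u,t) = (ψ(u,t), t), satisfies F^*(α − H dt) =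 λ · (α ⊕ 0), where (α − H dt)_{(u,t)}(v, a) = α_u(v) − H(u,t)·a and (α ⊕ 0)_{(u,t)}(v, a) = α_u(v). -/

import Mathlib

/-- `ℝ^{2n+1}`, written as `(x, y, z)` with `x, y ∈ ℝⁿ` and `z ∈ ℝ`. -/
abbrev EucOdd (n : ℕ) : Type := (Fin n → ℝ) × (Fin n → ℝ) × ℝ

/-- The standard contact form `α = dz + Σᵢ xᵢ dyᵢ` on `ℝ^{2n+1}`:
`(stdContactForm n p) (u, v, w) = w + Σᵢ pₓᵢ vᵢ`. -/
noncomputable def stdContactForm (n : ℕ) (p : EucOdd n) : EucOdd n →L[ℝ] ℝ :=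
  (ContinuousLinearMap.snd ℝ (Fin n → ℝ) ℝ).comp
      (ContinuousLinearMap.snd ℝ (Fin n → ℝ) ((Fin n → ℝ) × ℝ)) +
    ∑ i : Fin n, p.1 i •
      ((ContinuousLinearMap.proj i : (Fin n → ℝ) →L[ℝ] ℝ).comp
        ((ContinuousLinearMap.fst ℝ (Fin n → ℝ) ℝ).comp
          (ContinuousLinearMap.snd ℝ (Fin n → ℝ) ((Fin n → ℝ) × ℝ))))

/-- The constant 2-form `β = dα`: `β((u,v,w),(u',v',w')) = Σᵢ (uᵢ v'ᵢ − vᵢ u'ᵢ)`. -/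
def stdDContactForm (n : ℕ) (a b : EucOdd n) : ℝ :=
  ∑ i : Fin n, (a.1 i * b.2.1 i - a.2.1 i * b.1 i)

/-- The Reeb vector `R = (0, 0, 1)` of the standard contact form. -/
def stdReeb (n : ℕ) : EucOdd n := (0, 0, 1)

theorem stdContactForm_apply (n : ℕ) (p v : EucOdd n) :
    stdContactForm n p v = v.2.2 + ∑ i : Fin n, p.1 i * v.2.1 i := by
  simp [stdContactForm]

/-- Product rule for the contact form along a curve. -/
theorem HasDerivAt.stdContactForm {n : ℕ} {f w : ℝ → EucOdd n} {f' w' : EucOdd n} {t : ℝ}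
    (hf : HasDerivAt f f' t) (hw : HasDerivAt w w' t) :
    HasDerivAt (fun s => stdContactForm n (f s) (w s))
      (∑ i : Fin n, f'.1 i * (w t).2.1 i + _root_.stdContactForm n (f t) w') t := by
  simp only [stdContactForm_apply]
  have hx : ∀ i, HasDerivAt (fun s => (f s).1 i) (f'.1 i) t :=
    hasDerivAt_pi.1 hf.fst
  have hy : ∀ i, HasDerivAt (fun s => (w s).2.1 i) (w'.2.1 i) t :=
    hasDerivAt_pi.1 hw.snd.fst
  have hz : HasDerivAt (fun s => (w s).2.2) w'.2.2 t := hw.snd.snd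
  refine (hz.add (HasDerivAt.fun_sum fun i _ => (hx i).mul (hy i))).congr_deriv ?_
  rw [Finset.sum_add_distrib]
  ring

/-- A solution of the scalar linear equation `g' = θ g` is an exponential. -/
theorem eq_exp_integral_mul_of_hasDerivAt {a b : ℝ} {θ g : ℝ → ℝ}
    (h0 : (0 : ℝ) ∈ Set.Ioo a b) (hθ : ContinuousOn θ (Set.Ioo a b))
    (hg : ∀ t ∈ Set.Ioo a b, HasDerivAt g (θ t * g t) t) {t : ℝ} (ht : t ∈ Set.Ioo a b) :
    g t = Real.exp (∫ s in (0 : ℝ)..t, θ s) * g 0 := by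
  have hI : ∀ t ∈ Set.Ioo a b, HasDerivAt (fun t => ∫ s in (0 : ℝ)..t, θ s) (θ t) t := by
    intro t ht
    refine intervalIntegral.integral_hasDerivAt_right
      (hθ.mono (Set.OrdConnected.uIcc_subset Set.ordConnected_Ioo h0 ht)).intervalIntegrable
      (hθ.stronglyMeasurableAtFilter isOpen_Ioo t ht)
      (hθ.continuousAt (isOpen_Ioo.mem_nhds ht))
  have hk : ∀ t ∈ Set.Ioo a b,
      HasDerivAt (fun t => Real.exp (-∫ s in (0 : ℝ)..t, θ s) * g t) 0 t := by
    intro t ht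
    refine ((hI t ht).neg.exp.mul (hg t ht)).congr_deriv ?_
    simp only [Pi.neg_apply]
    ring
  have hc := isOpen_Ioo.is_const_of_deriv_eq_zero isPreconnected_Ioo
    (fun s hs => (hk s hs).differentiableAt.differentiableWithinAt)
    (fun s hs => (hk s hs).deriv) ht h0
  simp only [intervalIntegral.integral_same, neg_zero, Real.exp_zero, one_mul] at hc
  rw [← hc, ← mul_assoc, ← Real.exp_add, add_neg_cancel, Real.exp_zero, one_mul]

section Slice

variable {E F : Type*} [NormedAddCommGroup E] [NormedSpace ℝ E]
  [NormedAddCommGroup F] [NormedSpace ℝ F]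

theorem fderiv_slice_left {f : E × ℝ → F} {u : E} {t : ℝ}
    (hf : DifferentiableAt ℝ f (u, t)) (v : E) :
    fderiv ℝ (fun u' => f (u', t)) u v = fderiv ℝ f (u, t) (v, 0) := by
  have h : HasFDerivAt (fun u' => f (u', t)) _ u :=
    hf.hasFDerivAt.comp u (hasFDerivAt_prodMk_left u t)
  rw [h.fderiv]
  simp

theorem hasDerivAt_slice_right {f : E × ℝ → F} {u : E} {t : ℝ}
    (hf : DifferentiableAt ℝ f (u, t)) :
    HasDerivAt (fun s => f (u, s)) (fderiv ℝ f (u, t) (0, 1)) t :=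
  HasFDerivAt.comp_hasDerivAt t hf.hasFDerivAt ((hasDerivAt_const t u).prodMk (hasDerivAt_id t))

/-- The variational equation: the spatial derivative of a flow satisfies the linearised
equation. -/
theorem hasDerivAt_fderiv_flow {S : Set (E × ℝ)} (hS : IsOpen S) {ψ X : E × ℝ → E}
    (hψ : ContDiffOn ℝ 2 ψ S)
    (hflow : ∀ q ∈ S, HasDerivAt (fun s => ψ (q.1, s)) (X (ψ q, q.2)) q.2)
    {u : E} {t : ℝ} (hq : (u, t) ∈ S) (hX : DifferentiableAt ℝ X (ψ (u, t), t)) (v : E) :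
    HasDerivAt (fun s => fderiv ℝ ψ (u, s) (v, 0))
      (fderiv ℝ X (ψ (u, t), t) (fderiv ℝ ψ (u, t) (v, 0), 0)) t := by
  have hψat : ContDiffAt ℝ 2 ψ (u, t) := hψ.contDiffAt (hS.mem_nhds hq)
  have hd : DifferentiableAt ℝ (fderiv ℝ ψ) (u, t) :=
    (hψat.fderiv_right (m := 1) (by norm_num)).differentiableAt one_ne_zero
  have hsymm : IsSymmSndFDerivAt ℝ ψ (u, t) := hψat.isSymmSndFDerivAt (by simp)
  have htime : ∀ q ∈ S, fderiv ℝ ψ q (0, 1) = X (ψ q, q.2) := fun q hq' =>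
    (hasDerivAt_slice_right
      ((hψ.contDiffAt (hS.mem_nhds hq')).differentiableAt two_ne_zero)).unique (hflow q hq')
  have hev : (fun q => fderiv ℝ ψ q (0, 1)) =ᶠ[nhds (u, t)] fun q => X (ψ q, q.2) :=
    Filter.eventuallyEq_of_mem (hS.mem_nhds hq) htime
  have hleft : HasFDerivAt (fun q => fderiv ℝ ψ q (0, 1))
      ((fderiv ℝ (fderiv ℝ ψ) (u, t)).flip (0, 1)) (u, t) := by
    refine (hd.hasFDerivAt.clm_apply (hasFDerivAt_const _ _)).congr_fderiv ?_
    ext <;> simp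
  have hright : HasFDerivAt (fun q : E × ℝ => X (ψ q, q.2)) _ (u, t) :=
    HasFDerivAt.comp (u, t) (g := X) (f := fun q : E × ℝ => (ψ q, q.2)) hX.hasFDerivAt
      ((hψat.differentiableAt two_ne_zero).hasFDerivAt.prodMk hasFDerivAt_snd)
  have heq := congrArg (fun L => L (v, 0)) (hleft.unique (hright.congr_of_eventuallyEq hev))
  have hcurve := (hasDerivAt_slice_right hd).clm_apply (hasDerivAt_const t ((v, 0) : E × ℝ))
  refine hcurve.congr_deriv ?_
  simpa [hsymm.eq (0, 1) (v, 0)] using heq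

end Slice

/-- The Lie derivative of the standard contact form along a contact Hamiltonian vector field `Y`
with Hamiltonian `h`, evaluated on `w`: `(L_Y α)(w) = dh(R) α(w)`. -/
theorem stdContactForm_lieDeriv {n : ℕ} {h : EucOdd n → ℝ} {Y : EucOdd n → EucOdd n}
    {p : EucOdd n} (hY : DifferentiableAt ℝ Y p) (hh : DifferentiableAt ℝ h p)
    (hα : ∀ u, stdContactForm n u (Y u) = h u) (w : EucOdd n)
    (hβ : stdDContactForm n (Y p) w =
      -(fderiv ℝ h p w) + fderiv ℝ h p (stdReeb n) * stdContactForm n p w) :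
    ∑ i : Fin n, (Y p).1 i * w.2.1 i + stdContactForm n p (fderiv ℝ Y p w) =
      fderiv ℝ h p (stdReeb n) * stdContactForm n p w := by
  have hline : HasDerivAt (fun s : ℝ => p + s • w) w 0 := by
    simpa using ((hasDerivAt_id (0 : ℝ)).smul_const w).const_add p
  have hp : p = p + (0 : ℝ) • w := by simp
  have hYline : HasDerivAt (fun s : ℝ => Y (p + s • w)) (fderiv ℝ Y p w) 0 :=
    HasFDerivAt.comp_hasDerivAt_of_eq 0 hY.hasFDerivAt hline hp
  have hhline : HasDerivAt (fun s : ℝ => h (p + s • w)) (fderiv ℝ h p w) 0 :=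
    HasFDerivAt.comp_hasDerivAt_of_eq 0 hh.hasFDerivAt hline hp
  have hprod := hline.stdContactForm hYline
  simp only [hα, zero_smul, add_zero] at hprod
  have heq := hprod.unique hhline
  have hsum : stdDContactForm n (Y p) w =
      ∑ i : Fin n, (Y p).1 i * w.2.1 i - ∑ i : Fin n, w.1 i * (Y p).2.1 i := by
    simp [stdDContactForm, Finset.sum_sub_distrib, mul_comm]
  linarith

/-- Flow of the time-dependent contact Hamiltonian vector fields `X_{Hᵗ}`
on `(ℝ^{2n+1}, α_std)`: (a) `ψₜ* α = λₜ · α` with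
`λ(u,t) = exp(∫₀ᵗ D₁H(ψ(u,s),s)(R) ds)`; (b) the level-preserving map `F(u,t) = (ψ(u,t),t)`
pulls `α − H dt` back to `λ · (α ⊕ 0)`. -/
theorem contact_hamiltonian_flow
    (n : ℕ) (hn : 0 < n) (ε : ℝ) (hε : 0 < ε)
    (H : EucOdd n × ℝ → ℝ)
    (hH : ContDiffOn ℝ (⊤ : ℕ∞) H (Set.univ ×ˢ Set.Ioo (-ε) ε))
    (X : EucOdd n × ℝ → EucOdd n)
    (hXsm : ContDiffOn ℝ (⊤ : ℕ∞) X (Set.univ ×ˢ Set.Ioo (-ε) ε))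
    (hXα : ∀ (u : EucOdd n), ∀ t ∈ Set.Ioo (-ε) ε,
      stdContactForm n u (X (u, t)) = H (u, t))
    (hXβ : ∀ (u : EucOdd n), ∀ t ∈ Set.Ioo (-ε) ε, ∀ v : EucOdd n,
      stdDContactForm n (X (u, t)) v =
        -(fderiv ℝ (fun u' => H (u', t)) u v) +
          (fderiv ℝ (fun u' => H (u', t)) u (stdReeb n)) * stdContactForm n u v)
    (ψ : EucOdd n × ℝ → EucOdd n)
    (hψsm : ContDiffOn ℝ (⊤ : ℕ∞) ψ (Set.univ ×ˢ Set.Ioo (-ε) ε))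
    (hψ0 : ∀ u : EucOdd n, ψ (u, 0) = u)
    (hψt : ∀ (u : EucOdd n), ∀ t ∈ Set.Ioo (-ε) ε,
      HasDerivAt (fun s => ψ (u, s)) (X (ψ (u, t), t)) t)
    (lam : EucOdd n → ℝ → ℝ)
    (hlam : ∀ (u : EucOdd n) (t : ℝ), lam u t =
      Real.exp (∫ s in (0:ℝ)..t,
        fderiv ℝ (fun u' => H (u', s)) (ψ (u, s)) (stdReeb n))) :
    (∀ (u : EucOdd n), ∀ t ∈ Set.Ioo (-ε) ε, ∀ v : EucOdd n,
      stdContactForm n (ψ (u, t)) (fderiv ℝ (fun u' => ψ (u', t)) u v) =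
        lam u t * stdContactForm n u v) ∧
    (∀ (u : EucOdd n), ∀ t ∈ Set.Ioo (-ε) ε, ∀ (v : EucOdd n) (a : ℝ),
      stdContactForm n (ψ (u, t))
          ((fderiv ℝ (fun q : EucOdd n × ℝ => (ψ q, q.2)) (u, t) (v, a)).1) -
        H (ψ (u, t), t) * (fderiv ℝ (fun q : EucOdd n × ℝ => (ψ q, q.2)) (u, t) (v, a)).2 =
        lam u t * stdContactForm n u v) := by
  set S : Set (EucOdd n × ℝ) := Set.univ ×ˢ Set.Ioo (-ε) ε
  have hS : IsOpen S := isOpen_univ.prod isOpen_Ioo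
  have hmem : ∀ (u : EucOdd n), ∀ t ∈ Set.Ioo (-ε) ε, (u, t) ∈ S := fun u t ht =>
    ⟨Set.mem_univ u, ht⟩
  have h0 : (0 : ℝ) ∈ Set.Ioo (-ε) ε := ⟨neg_lt_zero.2 hε, hε⟩
  have hne : ((⊤ : ℕ∞) : WithTop ℕ∞) ≠ 0 := by simp
  have hHd : ∀ (u : EucOdd n), ∀ t ∈ Set.Ioo (-ε) ε, DifferentiableAt ℝ H (u, t) :=
    fun u t ht => (hH.contDiffAt (hS.mem_nhds (hmem u t ht))).differentiableAt hne
  have hXd : ∀ (u : EucOdd n), ∀ t ∈ Set.Ioo (-ε) ε, DifferentiableAt ℝ X (u, t) :=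
    fun u t ht => (hXsm.contDiffAt (hS.mem_nhds (hmem u t ht))).differentiableAt hne
  have hψd : ∀ (u : EucOdd n), ∀ t ∈ Set.Ioo (-ε) ε, DifferentiableAt ℝ ψ (u, t) :=
    fun u t ht => (hψsm.contDiffAt (hS.mem_nhds (hmem u t ht))).differentiableAt hne
  have hslice : ∀ (t : ℝ) (u : EucOdd n), DifferentiableAt ℝ (fun u' => (u', t)) u :=
    fun t u => (hasFDerivAt_prodMk_left u t).differentiableAt
  have hθ : ∀ u : EucOdd n, ContinuousOn
      (fun s => fderiv ℝ (fun u' => H (u', s)) (ψ (u, s)) (stdReeb n)) (Set.Ioo (-ε) ε) := by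
    intro u
    have hcurve : ContinuousOn (fun s => (ψ (u, s), s)) (Set.Ioo (-ε) ε) := fun s hs =>
      ((hψt u s hs).continuousAt.prodMk continuousAt_id).continuousWithinAt
    have hfd : ContinuousOn (fderiv ℝ H) S :=
      hH.continuousOn_fderiv_of_isOpen hS (by exact_mod_cast le_top)
    refine ((hfd.comp hcurve fun s hs => hmem _ s hs).clm_apply
      (continuousOn_const (c := (stdReeb n, (0 : ℝ))))).congr fun s hs => ?_
    exact fderiv_slice_left (hHd _ s hs) _
  have key : ∀ (u : EucOdd n), ∀ t ∈ Set.Ioo (-ε) ε, ∀ v : EucOdd n,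
      stdContactForm n (ψ (u, t)) (fderiv ℝ ψ (u, t) (v, 0)) =
        lam u t * stdContactForm n u v := by
    intro u t ht v
    have hode := eq_exp_integral_mul_of_hasDerivAt
      (g := fun s => stdContactForm n (ψ (u, s)) (fderiv ℝ ψ (u, s) (v, 0))) h0 (hθ u) ?_ ht
    · simp only [← fderiv_slice_left (hψd u 0 h0), hψ0, fderiv_fun_id,
        ContinuousLinearMap.id_apply] at hode
      rw [hlam, hode]
    · intro s hs
      have hw := hasDerivAt_fderiv_flow hS (hψsm.of_le (WithTop.coe_le_coe.2 (le_top (a := (2 : ℕ∞)))))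
        (fun q hq => hψt q.1 q.2 hq.2) (hmem u s hs) (hXd _ s hs) v
      refine ((hψt u s hs).stdContactForm hw).congr_deriv ?_
      rw [← fderiv_slice_left (hXd _ s hs)]
      exact stdContactForm_lieDeriv (h := fun u' => H (u', s)) (Y := fun u' => X (u', s))
        ((hXd _ s hs).comp (ψ (u, s)) (hslice s _)) ((hHd _ s hs).comp (ψ (u, s)) (hslice s _))
        (fun u' => hXα u' s hs) _ (hXβ _ s hs _)
  refine ⟨fun u t ht v => ?_, fun u t ht v a => ?_⟩
  · rw [fderiv_slice_left (hψd u t ht), key u t ht]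
  · have hF : HasFDerivAt (fun q : EucOdd n × ℝ => (ψ q, q.2)) _ (u, t) :=
      (hψd u t ht).hasFDerivAt.prodMk hasFDerivAt_snd
    have htime : fderiv ℝ ψ (u, t) (0, 1) = X (ψ (u, t), t) :=
      (hasDerivAt_slice_right (hψd u t ht)).unique (hψt u t ht)
    have hsplit : ((v, a) : EucOdd n × ℝ) = (v, 0) + a • (0, 1) := by simp
    have hval : fderiv ℝ ψ (u, t) (v, a) =
        fderiv ℝ ψ (u, t) (v, 0) + a • X (ψ (u, t), t) := by
      rw [hsplit, map_add, map_smul, htime]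
    rw [hF.fderiv]
    simp only [ContinuousLinearMap.prod_apply, ContinuousLinearMap.coe_snd', hval, map_add,
      map_smul, key u t ht, hXα _ t ht, smul_eq_mul]
    ring
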